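/- Let F₀ be a Borel probability distribution on ℝⁿ with finite second moment, let β ∈ ℝⁿ, and let ε ≥ 0. Then sup_{F∈B₂(F₀,ε)} Var^F(β^⊤Z) = ( (Var^{F₀}(β^⊤Z))^{1/2} + ε‖β‖_* )², where Var^F(β^⊤Z) denotes the variance of β^⊤Z when Z has distribution F. -/

import Mathlib

open MeasureTheory Set
open scoped ENNReal NNReal

noncomputable section

abbrev Vec (n : ℕ) := Fin n → ℝ

/-- `β^⊤x` -/
def dotp {n : ℕ} (β x : Vec n) : ℝ := ∑ i, β i * x i

/-- `nrm` is a norm on `ℝⁿ`. -/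
def IsNorm {n : ℕ} (nrm : Vec n → ℝ) : Prop :=
  (∀ x, nrm x = 0 ↔ x = 0) ∧
  (∀ (c : ℝ) (x : Vec n), nrm (c • x) = |c| * nrm x) ∧
  (∀ x y : Vec n, nrm (x + y) ≤ nrm x + nrm y)

/-- the dual norm `‖β‖_* = sup_{‖x‖ ≤ 1} β^⊤x`. -/
def dualNorm {n : ℕ} (nrm : Vec n → ℝ) (β : Vec n) : ℝ :=
  sSup {r | ∃ x, nrm x ≤ 1 ∧ r = dotp β x}

/-- Couplings of two probability measures. -/
def Couplings {E : Type*} [MeasurableSpace E] (μ ν : Measure E) : Set (Measure (E × E)) :=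
  {π | IsProbabilityMeasure π ∧ π.map Prod.fst = μ ∧ π.map Prod.snd = ν}

/-- The type-`p` Wasserstein distance (valued in `ℝ≥0∞`) associated with an
extended-real-valued cost; for `p = ∞` it is the infimum over couplings of the essential
supremum of the cost. -/
def WassersteinD {E : Type*} [MeasurableSpace E] (cost : E → E → ℝ≥0∞) (p : ℝ≥0∞)
    (μ ν : Measure E) : ℝ≥0∞ :=
  if p = ∞ then ⨅ π ∈ Couplings μ ν, essSup (fun z : E × E => cost z.1 z.2) π
  else ⨅ π ∈ Couplings μ ν, (∫⁻ z, cost z.1 z.2 ^ p.toReal ∂π) ^ (1 / p.toReal)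

/-- Finite `p`-th moment (with respect to a "norm-like" function `nrm`);
for `p = ∞` it means essential boundedness. -/
def HasMomentP {E : Type*} [MeasurableSpace E] (nrm : E → ℝ) (p : ℝ≥0∞) (μ : Measure E) : Prop :=
  if p = ∞ then essSup (fun x => ENNReal.ofReal (nrm x)) μ ≠ ∞
  else ∫⁻ x, ENNReal.ofReal (nrm x) ^ p.toReal ∂μ ≠ ∞

/-- The type-`p` Wasserstein ball of probability distributions on `ℝⁿ` (norm `nrm`). -/
def WballVec {n : ℕ} (nrm : Vec n → ℝ) (p : ℝ≥0∞) (μ₀ : Measure (Vec n)) (ε : ℝ) :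
    Set (Measure (Vec n)) :=
  {μ | IsProbabilityMeasure μ ∧ HasMomentP nrm p μ ∧
    WassersteinD (fun x y => ENNReal.ofReal (nrm (x - y))) p μ μ₀ ≤ ENNReal.ofReal ε}

/-- The type-`p` Wasserstein ball of probability distributions on `ℝ`
(absolute-value norm). -/
def WballReal (p : ℝ≥0∞) (μ₀ : Measure ℝ) (ε : ℝ) : Set (Measure ℝ) :=
  {μ | IsProbabilityMeasure μ ∧ HasMomentP (fun x : ℝ => |x|) p μ ∧
    WassersteinD (fun x y : ℝ => ENNReal.ofReal |x - y|) p μ μ₀ ≤ ENNReal.ofReal ε}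

/-- The metric on `Ξ = {-1,1} × ℝⁿ`:
`d((y₁,x₁),(y₂,x₂)) = ‖x₁ - x₂‖` if `y₁ = y₂`, and `+∞` otherwise. -/
def xiCost {n : ℕ} (nrm : Vec n → ℝ) (z₁ z₂ : ℝ × Vec n) : ℝ≥0∞ :=
  if z₁.1 = z₂.1 then ENNReal.ofReal (nrm (z₁.2 - z₂.2)) else ∞

/-- A measure on `ℝ × ℝⁿ` is concentrated on `Ξ = {-1,1} × ℝⁿ`. -/
def OnXi {n : ℕ} (μ : Measure (ℝ × Vec n)) : Prop :=
  μ {z | z.1 = 1 ∨ z.1 = -1} = 1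

/-- The type-`p` Wasserstein ball `B̄_p(F₀,ε)` of probability distributions on
`Ξ = {-1,1} × ℝⁿ`. -/
def WballXi {n : ℕ} (nrm : Vec n → ℝ) (p : ℝ≥0∞) (μ₀ : Measure (ℝ × Vec n)) (ε : ℝ) :
    Set (Measure (ℝ × Vec n)) :=
  {μ | IsProbabilityMeasure μ ∧ OnXi μ ∧ HasMomentP (fun z => nrm z.2) p μ ∧
    WassersteinD (xiCost nrm) p μ μ₀ ≤ ENNReal.ofReal ε}

open ProbabilityTheory


lemma dotp_add {n : ℕ} (β x y : Vec n) : dotp β (x + y) = dotp β x + dotp β y := by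
  simp [dotp, mul_add, Finset.sum_add_distrib]

lemma dotp_smul {n : ℕ} (β : Vec n) (c : ℝ) (x : Vec n) : dotp β (c • x) = c * dotp β x := by
  simp only [dotp, Pi.smul_apply, smul_eq_mul, Finset.mul_sum]
  exact Finset.sum_congr rfl fun i _ => by ring

lemma dotp_neg {n : ℕ} (β x : Vec n) : dotp β (-x) = -dotp β x := by
  simp [dotp]

@[fun_prop]
lemma continuous_dotp {n : ℕ} (β : Vec n) : Continuous (dotp β) := by
  unfold dotp
  fun_prop

namespace IsNorm

variable {n : ℕ} {nrm : Vec n → ℝ}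

lemma map_zero (h : IsNorm nrm) : nrm 0 = 0 := (h.1 0).2 rfl

lemma map_neg (h : IsNorm nrm) (x : Vec n) : nrm (-x) = nrm x := by
  simpa using h.2.1 (-1) x

lemma nonneg (h : IsNorm nrm) (x : Vec n) : 0 ≤ nrm x := by
  have h1 := h.2.2 x (-x)
  rw [add_neg_cancel, h.map_zero, h.map_neg] at h1
  linarith

lemma pos (h : IsNorm nrm) {x : Vec n} (hx : x ≠ 0) : 0 < nrm x :=
  lt_of_le_of_ne (h.nonneg x) fun h0 => hx ((h.1 x).1 h0.symm)

lemma continuous (h : IsNorm nrm) : Continuous nrm := by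
  have hc : ConvexOn ℝ univ nrm := by
    refine ⟨convex_univ, fun x _ y _ a b ha hb _ => ?_⟩
    have h1 := h.2.2 (a • x) (b • y)
    rwa [h.2.1, h.2.1, abs_of_nonneg ha, abs_of_nonneg hb] at h1
  exact continuousOn_univ.1 (hc.continuousOn isOpen_univ)

lemma exists_norm_le (h : IsNorm nrm) : ∃ C, 0 ≤ C ∧ ∀ x, ‖x‖ ≤ C * nrm x := by
  rcases (Metric.sphere (0 : Vec n) 1).eq_empty_or_nonempty with he | hne
  · refine ⟨0, le_rfl, fun x => ?_⟩
    by_cases hx : x = 0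
    · simp [hx]
    · have : ‖x‖⁻¹ • x ∈ Metric.sphere (0 : Vec n) 1 := by
        simp [norm_smul, norm_ne_zero_iff.2 hx]
      simp [he] at this
  · obtain ⟨u, hu, hmin⟩ := (isCompact_sphere (0 : Vec n) 1).exists_isMinOn hne
      h.continuous.continuousOn
    have hu0 : 0 < nrm u := h.pos fun h0 => by simp [h0] at hu
    refine ⟨(nrm u)⁻¹, by positivity, fun x => ?_⟩
    by_cases hx : x = 0
    · simp [hx, h.map_zero]
    · have hxn : 0 < ‖x‖ := norm_pos_iff.2 hx
      have hmem : ‖x‖⁻¹ • x ∈ Metric.sphere (0 : Vec n) 1 := by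
        simp [norm_smul, hxn.ne']
      have h1 : nrm u ≤ nrm (‖x‖⁻¹ • x) := hmin hmem
      rw [h.2.1, abs_of_pos (by positivity), inv_mul_eq_div, le_div_iff₀ hxn] at h1
      rw [inv_mul_eq_div, le_div_iff₀ hu0]
      linarith

lemma bddAbove_dotp (h : IsNorm nrm) (β : Vec n) :
    BddAbove {r | ∃ x, nrm x ≤ 1 ∧ r = dotp β x} := by
  obtain ⟨C, hC, hle⟩ := h.exists_norm_le
  refine ⟨∑ i, |β i| * C, ?_⟩
  rintro _ ⟨x, hx, rfl⟩
  refine Finset.sum_le_sum fun i _ => (le_abs_self _).trans ?_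
  rw [abs_mul]
  gcongr
  have h1 := norm_le_pi_norm x i
  rw [Real.norm_eq_abs] at h1
  nlinarith [hle x]

lemma dotp_le_dualNorm (h : IsNorm nrm) (β : Vec n) {x : Vec n} (hx : nrm x ≤ 1) :
    dotp β x ≤ dualNorm nrm β :=
  le_csSup (h.bddAbove_dotp β) ⟨x, hx, rfl⟩

lemma dualNorm_nonneg (h : IsNorm nrm) (β : Vec n) : 0 ≤ dualNorm nrm β := by
  simpa [dotp] using h.dotp_le_dualNorm β (x := 0) (by simp [h.map_zero])

lemma abs_dotp_le (h : IsNorm nrm) (β x : Vec n) : |dotp β x| ≤ dualNorm nrm β * nrm x := by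
  have key : ∀ y, dotp β y ≤ dualNorm nrm β * nrm y := by
    intro y
    by_cases hy : y = 0
    · simp [hy, h.map_zero, dotp]
    · have hp := h.pos hy
      have h1 := h.dotp_le_dualNorm β (x := (nrm y)⁻¹ • y) (by
        rw [h.2.1, abs_of_pos (by positivity), inv_mul_cancel₀ hp.ne'])
      rwa [dotp_smul, inv_mul_eq_div, div_le_iff₀ hp] at h1
  refine abs_le'.2 ⟨key x, ?_⟩
  simpa [dotp_neg, h.map_neg] using key (-x)

end IsNorm

section SecondMoment

variable {Ω : Type*} [MeasurableSpace Ω] {P : Measure Ω}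

lemma lintegral_ofReal_rpow_rpow_eq_eLpNorm {f : Ω → ℝ} (hf : ∀ ω, 0 ≤ f ω) :
    (∫⁻ ω, ENNReal.ofReal (f ω) ^ (2 : ℝ≥0∞).toReal ∂P) ^ (1 / (2 : ℝ≥0∞).toReal)
      = eLpNorm f 2 P := by
  rw [eLpNorm_eq_lintegral_rpow_enorm_toReal (by simp) (by simp)]
  simp_rw [Real.enorm_of_nonneg (hf _)]

lemma eLpNorm_two_eq_ofReal_sqrt {f : Ω → ℝ} (hf : MemLp f 2 P) :
    eLpNorm f 2 P = ENNReal.ofReal (√(∫ ω, f ω ^ 2 ∂P)) := by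
  rw [hf.eLpNorm_eq_integral_rpow_norm (by simp) (by simp)]
  simp [Real.sqrt_eq_rpow]

lemma hasMomentP_two_iff_memLp {n : ℕ} {nrm : Vec n → ℝ} (h : IsNorm nrm)
    {μ : Measure (Vec n)} : HasMomentP nrm 2 μ ↔ MemLp nrm 2 μ := by
  have hm : AEStronglyMeasurable nrm μ := h.continuous.aestronglyMeasurable
  rw [HasMomentP, if_neg (by simp), MemLp, and_iff_right hm,
    ← lintegral_ofReal_rpow_rpow_eq_eLpNorm h.nonneg, ← lt_top_iff_ne_top]
  simp [ENNReal.rpow_lt_top_iff_of_pos]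

lemma memLp_dotp {n : ℕ} {nrm : Vec n → ℝ} (h : IsNorm nrm) (β : Vec n)
    {X : Ω → Vec n} (hX : AEStronglyMeasurable X P) (hm : MemLp (fun ω => nrm (X ω)) 2 P) :
    MemLp (fun ω => dotp β (X ω)) 2 P := by
  refine (hm.const_mul (dualNorm nrm β)).mono'
    ((continuous_dotp β).comp_aestronglyMeasurable hX) (ae_of_all _ fun ω => ?_)
  exact h.abs_dotp_le β _

lemma sqrt_variance_add_le [IsProbabilityMeasure P] {X Y : Ω → ℝ}
    (hX : MemLp X 2 P) (hY : MemLp Y 2 P) :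
    √(variance (fun ω => X ω + Y ω) P) ≤ √(variance X P) + √(variance Y P) := by
  have hquad : ∀ t : ℝ,
      0 ≤ variance Y P * (t * t) + 2 * covariance X Y P * t + variance X P := by
    intro t
    have h1 := variance_nonneg (fun ω => X ω + t * Y ω) P
    rw [variance_fun_add hX (hY.const_mul t), variance_const_mul,
      covariance_const_mul_right] at h1
    linarith
  have hd := discrim_le_zero hquad
  rw [discrim] at hd
  have hcov : covariance X Y P ≤ √(variance X P) * √(variance Y P) := by
    rw [← Real.sqrt_mul (variance_nonneg _ _)]
    exact Real.le_sqrt_of_sq_le (by linarith)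
  rw [variance_fun_add hX hY]
  refine Real.sqrt_le_iff.2 ⟨by positivity, ?_⟩
  nlinarith [Real.sq_sqrt (variance_nonneg X P), Real.sq_sqrt (variance_nonneg Y P)]

end SecondMoment

section Wasserstein

variable {n : ℕ} {nrm : Vec n → ℝ}

lemma sqrt_variance_dotp_le_of_coupling (h : IsNorm nrm) (β : Vec n) {F F₀ : Measure (Vec n)}
    (hF₀ : MemLp nrm 2 F₀) {π : Measure (Vec n × Vec n)}
    (hπ : π ∈ Couplings F F₀) {r : ℝ} (hr : 0 ≤ r)
    (hcost : eLpNorm (fun z => nrm (z.1 - z.2)) 2 π ≤ ENNReal.ofReal r) :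
    √(variance (dotp β) F) ≤ √(variance (dotp β) F₀) + r * dualNorm nrm β := by
  obtain ⟨_, hfst, hsnd⟩ := hπ
  have hL := h.dualNorm_nonneg β
  have mp1 : MeasurePreserving Prod.fst π F := ⟨measurable_fst, hfst⟩
  have mp2 : MeasurePreserving Prod.snd π F₀ := ⟨measurable_snd, hsnd⟩
  have hc := h.continuous
  have hD : MemLp (fun z : Vec n × Vec n => nrm (z.1 - z.2)) 2 π :=
    ⟨by fun_prop, hcost.trans_lt ENNReal.ofReal_lt_top⟩
  have hY : MemLp (fun z : Vec n × Vec n => dotp β (z.1 - z.2)) 2 π :=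
    memLp_dotp h β (by fun_prop) hD
  have hX : MemLp (fun z : Vec n × Vec n => dotp β z.2) 2 π :=
    memLp_dotp h β (by fun_prop) (hF₀.comp_measurePreserving mp2)
  have hm : Measurable (dotp β) := (continuous_dotp β).measurable
  have hv1 : variance (dotp β) F = variance (fun z : Vec n × Vec n => dotp β z.1) π :=
    (mp1.variance_fun_comp hm.aemeasurable).symm
  have hv2 : variance (dotp β) F₀ = variance (fun z : Vec n × Vec n => dotp β z.2) π :=
    (mp2.variance_fun_comp hm.aemeasurable).symm
  have hsum : (fun z : Vec n × Vec n => dotp β z.1)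
      = fun z => dotp β z.2 + dotp β (z.1 - z.2) := by
    funext z
    rw [← dotp_add, add_sub_cancel]
  rw [hv1, hv2, hsum]
  refine (sqrt_variance_add_le hX hY).trans (by
    gcongr
    refine Real.sqrt_le_iff.2 ⟨by positivity, ?_⟩
    rw [eLpNorm_two_eq_ofReal_sqrt hD, ENNReal.ofReal_le_ofReal_iff hr,
      Real.sqrt_le_left hr] at hcost
    calc variance (fun z : Vec n × Vec n => dotp β (z.1 - z.2)) π
        ≤ ∫ z, dotp β (z.1 - z.2) ^ 2 ∂π := variance_le_expectation_sq hY.aestronglyMeasurable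
      _ ≤ ∫ z, dualNorm nrm β ^ 2 * nrm (z.1 - z.2) ^ 2 ∂π := by
          refine integral_mono hY.integrable_sq (hD.integrable_sq.const_mul _) fun z => ?_
          simp only
          rw [← mul_pow, ← sq_abs]
          exact pow_le_pow_left₀ (abs_nonneg _) (h.abs_dotp_le β _) 2
      _ = dualNorm nrm β ^ 2 * ∫ z, nrm (z.1 - z.2) ^ 2 ∂π := integral_const_mul _ _
      _ ≤ (r * dualNorm nrm β) ^ 2 := by
          rw [mul_pow, mul_comm]
          gcongr)

lemma sqrt_variance_dotp_le_of_mem_WballVec (h : IsNorm nrm) (β : Vec n)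
    {F F₀ : Measure (Vec n)} (hF₀ : MemLp nrm 2 F₀) {ε : ℝ} (hε : 0 ≤ ε)
    (hF : F ∈ WballVec nrm 2 F₀ ε) :
    √(variance (dotp β) F) ≤ √(variance (dotp β) F₀) + ε * dualNorm nrm β := by
  obtain ⟨_, _, hW⟩ := hF
  have hL := h.dualNorm_nonneg β
  have key : ∀ r, ε < r →
      √(variance (dotp β) F) ≤ √(variance (dotp β) F₀) + r * dualNorm nrm β := by
    intro r hr
    have hlt := hW.trans_lt ((ENNReal.ofReal_lt_ofReal_iff (hε.trans_lt hr)).2 hr)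
    rw [WassersteinD, if_neg (by simp)] at hlt
    simp only [iInf_lt_iff] at hlt
    obtain ⟨π, hπ, hlt⟩ := hlt
    rw [lintegral_ofReal_rpow_rpow_eq_eLpNorm fun _ => h.nonneg _] at hlt
    exact sqrt_variance_dotp_le_of_coupling h β hF₀ hπ
      (hε.trans hr.le) hlt.le
  have hcont : Continuous fun r : ℝ => √(variance (dotp β) F₀) + r * dualNorm nrm β := by
    fun_prop
  refine ge_of_tendsto (hcont.continuousWithinAt (s := Ioi ε) (x := ε)) ?_
  filter_upwards [self_mem_nhdsWithin] with r hr using key r hr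

lemma map_add_smul_mem_WballVec (h : IsNorm nrm) {F₀ : Measure (Vec n)} (hF₀ : MemLp nrm 2 F₀)
    {ε : ℝ} (hε : 0 ≤ ε) {Ω : Type*} [MeasurableSpace Ω] {P : Measure Ω}
    [IsProbabilityMeasure P] {Z : Ω → Vec n} (hZ : MeasurePreserving Z P F₀) {s : Ω → ℝ}
    (hs : Measurable s) (hsL : MemLp s 2 P) (hs1 : ∫ ω, s ω ^ 2 ∂P ≤ 1) {x : Vec n}
    (hx : nrm x ≤ 1) :
    P.map (fun ω => Z ω + (ε * s ω) • x) ∈ WballVec nrm 2 F₀ ε := by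
  have hc := h.continuous
  have hZm := hZ.measurable
  have hXm : Measurable fun ω => Z ω + (ε * s ω) • x := by fun_prop
  refine ⟨Measure.isProbabilityMeasure_map hXm.aemeasurable, ?_, ?_⟩
  · rw [hasMomentP_two_iff_memLp h, memLp_map_measure_iff hc.aestronglyMeasurable hXm.aemeasurable]
    refine ((hF₀.comp_measurePreserving hZ).add (hsL.norm.const_mul ε)).mono'
      (hc.measurable.comp hXm).aestronglyMeasurable (ae_of_all _ fun ω => ?_)
    simp only [Function.comp_apply, Pi.add_apply, Real.norm_eq_abs]
    rw [abs_of_nonneg (h.nonneg _)]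
    refine (h.2.2 _ _).trans ?_
    rw [h.2.1, abs_mul, abs_of_nonneg hε]
    rw [mul_assoc]
    gcongr
    exact mul_le_of_le_one_right (abs_nonneg _) hx
  · rw [WassersteinD, if_neg (by simp)]
    have hpm : Measurable fun ω => (Z ω + (ε * s ω) • x, Z ω) := hXm.prodMk hZm
    refine iInf₂_le_of_le (P.map fun ω => (Z ω + (ε * s ω) • x, Z ω))
      ⟨Measure.isProbabilityMeasure_map hpm.aemeasurable, ?_, ?_⟩ ?_
    · rw [Measure.map_map measurable_fst hpm]
      rfl
    · rw [Measure.map_map measurable_snd hpm]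
      exact hZ.map_eq
    · have hcost : Continuous fun z : Vec n × Vec n => nrm (z.1 - z.2) := by fun_prop
      have heq : (fun z : Vec n × Vec n => nrm (z.1 - z.2)) ∘
          (fun ω => (Z ω + (ε * s ω) • x, Z ω)) = fun ω => (ε * nrm x) * ‖s ω‖ := by
        funext ω
        simp only [Function.comp_apply, add_sub_cancel_left]
        rw [h.2.1, abs_mul, abs_of_nonneg hε, Real.norm_eq_abs]
        ring
      rw [lintegral_ofReal_rpow_rpow_eq_eLpNorm fun _ => h.nonneg _,
        eLpNorm_map_measure hcost.aestronglyMeasurable hpm.aemeasurable, heq,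
        eLpNorm_two_eq_ofReal_sqrt (hsL.norm.const_mul _)]
      refine ENNReal.ofReal_le_ofReal (Real.sqrt_le_iff.2 ⟨hε, ?_⟩)
      simp only [mul_pow, Real.norm_eq_abs, sq_abs]
      rw [integral_const_mul, mul_assoc]
      refine mul_le_of_le_one_right (by positivity) ?_
      exact mul_le_one₀ (pow_le_one₀ (h.nonneg x) hx) (integral_nonneg fun _ => sq_nonneg _) hs1

lemma exists_mem_WballVec_variance_dotp_eq (h : IsNorm nrm) (β : Vec n) {F₀ : Measure (Vec n)}
    [IsProbabilityMeasure F₀] (hF₀ : MemLp nrm 2 F₀) {ε : ℝ} (hε : 0 ≤ ε) {x : Vec n}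
    (hx : nrm x ≤ 1) :
    ∃ F ∈ WballVec nrm 2 F₀ ε,
      variance (dotp β) F = (√(variance (dotp β) F₀) + ε * dotp β x) ^ 2 := by
  have hdm : Measurable (dotp β) := (continuous_dotp β).measurable
  have hX : MemLp (dotp β) 2 F₀ := memLp_dotp h β aestronglyMeasurable_id hF₀
  by_cases hv : variance (dotp β) F₀ = 0
  · have hid : MemLp (id : ℝ → ℝ) 2 (gaussianReal 0 1) := memLp_id_gaussianReal' 2 (by simp)
    have mps : MeasurePreserving Prod.snd (F₀.prod (gaussianReal 0 1)) (gaussianReal 0 1) :=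
      measurePreserving_snd
    have mpf : MeasurePreserving Prod.fst (F₀.prod (gaussianReal 0 1)) F₀ :=
      measurePreserving_fst
    have hvar : variance (fun ω : Vec n × ℝ => ω.2) (F₀.prod (gaussianReal 0 1)) = 1 := by
      have h1 := mps.variance_fun_comp (f := id) aemeasurable_id
      rw [variance_id_gaussianReal] at h1
      simpa using h1
    have hint : ∫ ω : Vec n × ℝ, ω.2 ∂(F₀.prod (gaussianReal 0 1)) = 0 := by
      have h1 := integral_map (μ := F₀.prod (gaussianReal 0 1)) measurable_snd.aemeasurable
        (aestronglyMeasurable_id (α := ℝ))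
      rw [mps.map_eq] at h1
      exact h1.symm.trans integral_id_gaussianReal
    have hs1 : ∫ ω : Vec n × ℝ, ω.2 ^ 2 ∂(F₀.prod (gaussianReal 0 1)) ≤ 1 := by
      rw [← variance_of_integral_eq_zero measurable_snd.aemeasurable hint, hvar]
    refine ⟨_, map_add_smul_mem_WballVec h hF₀ hε mpf measurable_snd
      (hid.comp_measurePreserving mps) hs1 hx, ?_⟩
    rw [variance_map hdm.aemeasurable (by fun_prop), hv]
    have hae : dotp β ∘ (fun ω : Vec n × ℝ => ω.1 + (ε * ω.2) • x)
        =ᵐ[F₀.prod (gaussianReal 0 1)]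
          fun ω => (∫ y, dotp β y ∂F₀) + (ε * dotp β x) * ω.2 := by
      filter_upwards [mpf.quasiMeasurePreserving.ae (ae_eq_integral_of_variance_eq_zero hX hv)]
        with ω hω
      simp only [Function.comp_apply, dotp_add, dotp_smul, hω]
      ring
    rw [variance_congr hae, variance_const_add (by fun_prop), variance_const_mul, hvar]
    simp
  · set σ := √(variance (dotp β) F₀) with hσ
    have hσ2 : σ ^ 2 = variance (dotp β) F₀ := Real.sq_sqrt (variance_nonneg _ _)
    have hσ0 : σ ≠ 0 := fun h0 => hv (by rw [← hσ2, h0]; simp)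
    have hsL : MemLp (fun y => σ⁻¹ * (dotp β y - ∫ y, dotp β y ∂F₀)) 2 F₀ :=
      (hX.sub (memLp_const _)).const_mul _
    have hs1 : ∫ y, (σ⁻¹ * (dotp β y - ∫ y, dotp β y ∂F₀)) ^ 2 ∂F₀ ≤ 1 := by
      simp only [mul_pow]
      rw [integral_const_mul, ← variance_eq_integral hdm.aemeasurable, ← hσ2, ← mul_pow,
        inv_mul_cancel₀ hσ0, one_pow]
    refine ⟨_, map_add_smul_mem_WballVec h hF₀ hε (MeasurePreserving.id F₀) (by fun_prop)
      hsL hs1 hx, ?_⟩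
    rw [variance_map hdm.aemeasurable (by fun_prop)]
    have heq : dotp β ∘ (fun y => id y +
          (ε * (σ⁻¹ * (dotp β y - ∫ y, dotp β y ∂F₀))) • x)
        = fun y => -(ε * dotp β x * σ⁻¹ * ∫ y, dotp β y ∂F₀) +
            (1 + ε * dotp β x * σ⁻¹) * dotp β y := by
      funext y
      simp only [Function.comp_apply, dotp_add, dotp_smul, id]
      ring
    rw [heq, variance_const_add (by fun_prop), variance_const_mul, ← hσ2]
    field_simp

end Wasserstein

/-- Example 7 of the paper, cf. Blanchet–Chen–Zhou: the worst-case
variance of `β^⊤Z` over a type-2 Wasserstein ball equals `(√Var^{F₀}(β^⊤Z) + ε‖β‖_*)²`. -/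
theorem stmt19 {n : ℕ} (nrm : Vec n → ℝ) (hnrm : IsNorm nrm)
    (F₀ : Measure (Vec n)) (hF₀ : IsProbabilityMeasure F₀)
    (hmom : HasMomentP nrm 2 F₀)
    (β : Vec n) (ε : ℝ) (hε : 0 ≤ ε) :
    sSup {r | ∃ F ∈ WballVec nrm 2 F₀ ε, r = variance (fun x => dotp β x) F}
      = (Real.sqrt (variance (fun x => dotp β x) F₀) + ε * dualNorm nrm β) ^ 2 := by
  have hF₀L : MemLp nrm 2 F₀ := (hasMomentP_two_iff_memLp hnrm).1 hmom
  have hL := hnrm.dualNorm_nonneg β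
  set σ := √(variance (fun x => dotp β x) F₀) with hσ
  have hub : ∀ r ∈ {r | ∃ F ∈ WballVec nrm 2 F₀ ε, r = variance (fun x => dotp β x) F},
      r ≤ (σ + ε * dualNorm nrm β) ^ 2 := by
    rintro _ ⟨F, hF, rfl⟩
    exact (Real.sqrt_le_left (by positivity)).1
      (sqrt_variance_dotp_le_of_mem_WballVec hnrm β hF₀L hε hF)
  have hattain : ∀ x, nrm x ≤ 1 → (σ + ε * dotp β x) ^ 2 ∈
      {r | ∃ F ∈ WballVec nrm 2 F₀ ε, r = variance (fun x => dotp β x) F} := by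
    intro x hx
    obtain ⟨F, hF, hv⟩ := exists_mem_WballVec_variance_dotp_eq hnrm β hF₀L hε hx
    exact ⟨F, hF, hv.symm⟩
  have h0 : nrm 0 ≤ 1 := by simp [hnrm.map_zero]
  refine le_antisymm (csSup_le ⟨_, hattain 0 h0⟩ hub) ?_
  set S := sSup {r | ∃ F ∈ WballVec nrm 2 F₀ ε, r = variance (fun x => dotp β x) F}
  have hle : ∀ x, nrm x ≤ 1 → σ + ε * dotp β x ≤ √S := fun x hx =>
    Real.le_sqrt_of_sq_le (le_csSup ⟨_, hub⟩ (hattain x hx))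
  have hS : 0 ≤ S := (sq_nonneg _).trans (le_csSup ⟨_, hub⟩ (hattain 0 h0))
  refine (Real.le_sqrt (by positivity) hS).1 ?_
  rcases hε.eq_or_lt with rfl | hε
  · simpa using hle 0 h0
  · have hdual : dualNorm nrm β ≤ (√S - σ) / ε := by
      refine csSup_le ⟨_, 0, h0, rfl⟩ ?_
      rintro _ ⟨x, hx, rfl⟩
      rw [le_div_iff₀ hε]
      linarith [hle x hx]
    rw [le_div_iff₀ hε] at hdual
    linarith
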